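/- For every φ ∈ ℝ, let R_φ : ℝ^8 → ℝ^8 be the linear isometry which, under the identification ℝ^8 ≅ ℂ^4, sends (z₁,z₂,z₃,z₄) to (e^{iφ}z₁,z₂,z₃,z₄). Then the pullback of the Cayley form Ω₀ along R_φ equals (1/2)·ω₀∧ω₀ + Re(e^{iφ}·θ₀). In particular, for every φ the 4-form (1/2)·ω₀∧ω₀ + Re(e^{iφ}θ₀) lies in the orbit of Ω₀ under pullback by orientation-preserving linear isometries of ℝ^8. -/

import Mathlib

noncomputable section

/-- `dx_i ∧ dx_j ∧ dx_k ∧ dx_l` as a constant alternating 4-form on `ℝ^8`: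
its value on vectors `v₁,…,v₄` is the determinant of the 4×4 matrix of the
`i,j,k,l`-th coordinates of the `v`'s. -/
def dx4 (i j k l : Fin 8) : AlternatingMap ℝ (Fin 8 → ℝ) ℝ (Fin 4) :=
  (Matrix.detRowAlternating : AlternatingMap ℝ (Fin 4 → ℝ) ℝ (Fin 4)).compLinearMap
    (LinearMap.pi fun a => LinearMap.proj (![i, j, k, l] a))

/-- `dx_i ∧ dx_j` as a constant alternating 2-form on `ℝ^8`. -/
def dx2 (i j : Fin 8) : AlternatingMap ℝ (Fin 8 → ℝ) ℝ (Fin 2) :=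
  (Matrix.detRowAlternating : AlternatingMap ℝ (Fin 2 → ℝ) ℝ (Fin 2)).compLinearMap
    (LinearMap.pi fun a => LinearMap.proj (![i, j] a))

/-- The Cayley 4-form `Ω₀` on `ℝ^8` (indices shifted to `0,…,7`). -/
def CayleyForm : AlternatingMap ℝ (Fin 8 → ℝ) ℝ (Fin 4) :=
  dx4 0 1 2 3 + dx4 0 1 4 5 + dx4 0 1 6 7 + dx4 0 2 4 6 - dx4 0 2 5 7 - dx4 0 3 4 7
    - dx4 0 3 5 6 + dx4 4 5 6 7 + dx4 2 3 6 7 + dx4 2 3 4 5 + dx4 1 3 5 7 - dx4 1 3 4 6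
    - dx4 1 2 5 6 - dx4 1 2 4 7

/-- The standard Kähler form `ω₀ = dx₁∧dx₂ + dx₃∧dx₄ + dx₅∧dx₆ + dx₇∧dx₈` on `ℝ^8 ≅ ℂ^4`. -/
def omega0 : AlternatingMap ℝ (Fin 8 → ℝ) ℝ (Fin 2) :=
  dx2 0 1 + dx2 2 3 + dx2 4 5 + dx2 6 7

/-- The wedge product of two alternating 2-forms on `ℝ^8`, as an alternating 4-form
(determinant/shuffle convention, so that `dx_{12} ∧ dx_{34} = dx_{1234}`). -/
def wedge22 (α β : AlternatingMap ℝ (Fin 8 → ℝ) ℝ (Fin 2)) :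
    AlternatingMap ℝ (Fin 8 → ℝ) ℝ (Fin 4) :=
  AlternatingMap.domDomCongr finSumFinEquiv
    ((TensorProduct.lid ℝ ℝ).toLinearMap.compAlternatingMap (α.domCoprod β))

/-- The `ℝ`-linear map `ℝ^8 → ℂ^4`, `x ↦ (z₁,…,z₄)` with `z_j = x_{2j－1} + i·x_{2j}`. -/
def dzLin : (Fin 8 → ℝ) →ₗ[ℝ] (Fin 4 → ℂ) :=
  LinearMap.pi fun j =>
    Complex.ofRealAm.toLinearMap.comp (LinearMap.proj (⟨2 * j.val, by omega⟩ : Fin 8)) +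
      Complex.I • Complex.ofRealAm.toLinearMap.comp (LinearMap.proj (⟨2 * j.val + 1, by omega⟩ : Fin 8))

/-- The complex determinant on `ℂ^4`, viewed as an `ℝ`-alternating 4-form. -/
def detC4R : AlternatingMap ℝ (Fin 4 → ℂ) ℂ (Fin 4) :=
  { (Matrix.detRowAlternating :
        AlternatingMap ℂ (Fin 4 → ℂ) ℂ (Fin 4)).toMultilinearMap.restrictScalars ℝ with
    map_eq_zero_of_eq' := fun v i j h hij =>
      (Matrix.detRowAlternating : AlternatingMap ℂ (Fin 4 → ℂ) ℂ (Fin 4)).map_eq_zero_of_eq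
        v h hij }

/-- The holomorphic volume form `θ₀ = dz₁∧dz₂∧dz₃∧dz₄`, a complex-valued
`ℝ`-alternating 4-form on `ℝ^8`. -/
def Theta0 : AlternatingMap ℝ (Fin 8 → ℝ) ℂ (Fin 4) :=
  detC4R.compLinearMap dzLin

/-- The matrix of the linear isometry `R_φ` of `ℝ^8 ≅ ℂ^4` sending
`(z₁,z₂,z₃,z₄)` to `(e^{iφ}z₁,z₂,z₃,z₄)`. -/
def RphiMat (φ : ℝ) : Matrix (Fin 8) (Fin 8) ℝ :=
  !![Real.cos φ, -Real.sin φ, 0, 0, 0, 0, 0, 0;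
     Real.sin φ, Real.cos φ, 0, 0, 0, 0, 0, 0;
     0, 0, 1, 0, 0, 0, 0, 0;
     0, 0, 0, 1, 0, 0, 0, 0;
     0, 0, 0, 0, 1, 0, 0, 0;
     0, 0, 0, 0, 0, 1, 0, 0;
     0, 0, 0, 0, 0, 0, 1, 0;
     0, 0, 0, 0, 0, 0, 0, 1]

/-- `R_φ` as a linear map `ℝ^8 → ℝ^8`. -/
def Rphi (φ : ℝ) : (Fin 8 → ℝ) →ₗ[ℝ] (Fin 8 → ℝ) := Matrix.toLin' (RphiMat φ)

/-- The determinant formula for `dx4`. -/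
theorem dx4_eval (i j k l : Fin 8) (v : Fin 4 → Fin 8 → ℝ) :
    dx4 i j k l v = Matrix.det (Matrix.of fun a b => v a (![i, j, k, l] b)) := rfl

theorem det4 {R : Type*} [CommRing R] (M : Matrix (Fin 4) (Fin 4) R) :
    M.det =
      (M 0 0 * M 1 1 - M 0 1 * M 1 0) * (M 2 2 * M 3 3 - M 2 3 * M 3 2)
      - (M 0 0 * M 1 2 - M 0 2 * M 1 0) * (M 2 1 * M 3 3 - M 2 3 * M 3 1)
      + (M 0 0 * M 1 3 - M 0 3 * M 1 0) * (M 2 1 * M 3 2 - M 2 2 * M 3 1)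
      + (M 0 1 * M 1 2 - M 0 2 * M 1 1) * (M 2 0 * M 3 3 - M 2 3 * M 3 0)
      - (M 0 1 * M 1 3 - M 0 3 * M 1 1) * (M 2 0 * M 3 2 - M 2 2 * M 3 0)
      + (M 0 2 * M 1 3 - M 0 3 * M 1 2) * (M 2 0 * M 3 1 - M 2 1 * M 3 0) := by
  rw [Matrix.det_succ_row_zero]
  simp [Fin.sum_univ_succ, Matrix.det_fin_three, Fin.succAbove]
  ring

theorem dx4_expand (i j k l : Fin 8) (v : Fin 4 → Fin 8 → ℝ) :
    dx4 i j k l v =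
      (v 0 i * v 1 j - v 0 j * v 1 i) * (v 2 k * v 3 l - v 2 l * v 3 k)
      - (v 0 i * v 1 k - v 0 k * v 1 i) * (v 2 j * v 3 l - v 2 l * v 3 j)
      + (v 0 i * v 1 l - v 0 l * v 1 i) * (v 2 j * v 3 k - v 2 k * v 3 j)
      + (v 0 j * v 1 k - v 0 k * v 1 j) * (v 2 i * v 3 l - v 2 l * v 3 i)
      - (v 0 j * v 1 l - v 0 l * v 1 j) * (v 2 i * v 3 k - v 2 k * v 3 i)
      + (v 0 k * v 1 l - v 0 l * v 1 k) * (v 2 i * v 3 j - v 2 j * v 3 i) := by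
  rw [dx4_eval, det4]
  rfl

theorem dx2_expand (i j : Fin 8) (v : Fin 2 → Fin 8 → ℝ) :
    dx2 i j v = v 0 i * v 1 j - v 0 j * v 1 i := by
  change Matrix.det (Matrix.of fun a b => v a (![i, j] b)) = _
  rw [Matrix.det_fin_two]
  rfl

theorem Rphi_zero (φ : ℝ) (v : Fin 8 → ℝ) :
    Rphi φ v 0 = Real.cos φ * v 0 - Real.sin φ * v 1 := by
  simp [Rphi, RphiMat, Matrix.mulVec, dotProduct, Fin.sum_univ_succ]
  ring

theorem Rphi_one (φ : ℝ) (v : Fin 8 → ℝ) :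
    Rphi φ v 1 = Real.sin φ * v 0 + Real.cos φ * v 1 := by
  simp [Rphi, RphiMat, Matrix.mulVec, dotProduct, Fin.sum_univ_succ]

theorem Rphi_ge (φ : ℝ) (v : Fin 8 → ℝ) (k : Fin 8) (hk : 2 ≤ k) : Rphi φ v k = v k := by
  fin_cases k <;> first
    | (exfalso; revert hk; decide)
    | simp [Rphi, RphiMat, Matrix.mulVec, dotProduct, Fin.sum_univ_succ]

theorem Rphi_det (φ : ℝ) : LinearMap.det (Rphi φ) = 1 := by
  have h := Real.cos_sq_add_sin_sq φ
  have hb : RphiMat φ = Matrix.submatrix (Matrix.fromBlocks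
      !![Real.cos φ, -Real.sin φ; Real.sin φ, Real.cos φ] 0 0 (1 : Matrix (Fin 6) (Fin 6) ℝ))
      (finSumFinEquiv (m := 2) (n := 6)).symm (finSumFinEquiv (m := 2) (n := 6)).symm := by
    rw [← Matrix.reindex_apply, ← Equiv.symm_apply_eq]
    ext a b
    rcases a with a | a <;> rcases b with b | b <;> fin_cases a <;> fin_cases b <;> rfl
  rw [Rphi, LinearMap.det_toLin', hb, Matrix.det_submatrix_equiv_self,
    Matrix.det_fromBlocks_zero₂₁, Matrix.det_fin_two, Matrix.det_one]
  simp
  linarith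

theorem Rphi_isometry (φ : ℝ) (v w : Fin 8 → ℝ) :
    ∑ i, Rphi φ v i * Rphi φ w i = ∑ i, v i * w i := by
  have h := Real.cos_sq_add_sin_sq φ
  simp only [Fin.sum_univ_eight, Rphi_zero, Rphi_one]
  rw [Rphi_ge φ v 2 (by decide), Rphi_ge φ v 3 (by decide), Rphi_ge φ v 4 (by decide),
    Rphi_ge φ v 5 (by decide), Rphi_ge φ v 6 (by decide), Rphi_ge φ v 7 (by decide),
    Rphi_ge φ w 2 (by decide), Rphi_ge φ w 3 (by decide), Rphi_ge φ w 4 (by decide),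
    Rphi_ge φ w 5 (by decide), Rphi_ge φ w 6 (by decide), Rphi_ge φ w 7 (by decide)]
  linear_combination (v 0 * w 0 + v 1 * w 1) * h

theorem pull_01 (φ : ℝ) (k l : Fin 8) (hk : 2 ≤ k) (hl : 2 ≤ l) (v : Fin 4 → Fin 8 → ℝ) :
    dx4 0 1 k l (fun a => Rphi φ (v a)) = dx4 0 1 k l v := by
  have h := Real.cos_sq_add_sin_sq φ
  simp only [dx4_expand, Rphi_zero, Rphi_one, Rphi_ge φ _ k hk, Rphi_ge φ _ l hl]
  have e := dx4_expand 0 1 k l v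
  linear_combination dx4 0 1 k l v * h - (Real.cos φ ^ 2 + Real.sin φ ^ 2 - 1) * e

theorem pull_0 (φ : ℝ) (j k l : Fin 8) (hj : 2 ≤ j) (hk : 2 ≤ k) (hl : 2 ≤ l)
    (v : Fin 4 → Fin 8 → ℝ) :
    dx4 0 j k l (fun a => Rphi φ (v a)) =
      Real.cos φ * dx4 0 j k l v - Real.sin φ * dx4 1 j k l v := by
  simp only [dx4_expand, Rphi_zero, Rphi_ge φ _ j hj, Rphi_ge φ _ k hk, Rphi_ge φ _ l hl]
  ring

theorem pull_1 (φ : ℝ) (j k l : Fin 8) (hj : 2 ≤ j) (hk : 2 ≤ k) (hl : 2 ≤ l)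
    (v : Fin 4 → Fin 8 → ℝ) :
    dx4 1 j k l (fun a => Rphi φ (v a)) =
      Real.sin φ * dx4 0 j k l v + Real.cos φ * dx4 1 j k l v := by
  simp only [dx4_expand, Rphi_one, Rphi_ge φ _ j hj, Rphi_ge φ _ k hk, Rphi_ge φ _ l hl]
  ring

theorem pull_none (φ : ℝ) (i j k l : Fin 8) (hi : 2 ≤ i) (hj : 2 ≤ j) (hk : 2 ≤ k) (hl : 2 ≤ l)
    (v : Fin 4 → Fin 8 → ℝ) :
    dx4 i j k l (fun a => Rphi φ (v a)) = dx4 i j k l v := by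
  simp only [dx4_expand, Rphi_ge φ _ i hi, Rphi_ge φ _ j hj, Rphi_ge φ _ k hk, Rphi_ge φ _ l hl]

theorem dzLin_apply (x : Fin 8 → ℝ) :
    dzLin x = ![⟨x 0, x 1⟩, ⟨x 2, x 3⟩, ⟨x 4, x 5⟩, ⟨x 6, x 7⟩] := by
  ext j
  fin_cases j <;> apply Complex.ext <;> simp [dzLin]

theorem Theta0_eq (v : Fin 4 → Fin 8 → ℝ) :
    Theta0 v = Matrix.det (Matrix.of fun a => dzLin (v a)) := rfl

theorem Theta0_re (v : Fin 4 → Fin 8 → ℝ) :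
    (Theta0 v).re = dx4 0 2 4 6 v - dx4 0 2 5 7 v - dx4 0 3 4 7 v - dx4 0 3 5 6 v
      - dx4 1 2 4 7 v - dx4 1 2 5 6 v - dx4 1 3 4 6 v + dx4 1 3 5 7 v := by
  rw [Theta0_eq, det4]
  simp only [Matrix.of_apply, dzLin_apply, dx4_expand]
  simp
  ring

theorem Theta0_im (v : Fin 4 → Fin 8 → ℝ) :
    (Theta0 v).im = dx4 1 2 4 6 v + dx4 0 3 4 6 v + dx4 0 2 5 6 v + dx4 0 2 4 7 v
      - dx4 0 3 5 7 v - dx4 1 2 5 7 v - dx4 1 3 4 7 v - dx4 1 3 5 6 v := by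
  rw [Theta0_eq, det4]
  simp only [Matrix.of_apply, dzLin_apply, dx4_expand]
  simp
  ring

theorem four_wedge22 (α β : AlternatingMap ℝ (Fin 8 → ℝ) ℝ (Fin 2)) (v : Fin 4 → Fin 8 → ℝ) :
    4 * wedge22 α β v = ∑ σ : Equiv.Perm (Fin 4), ((Equiv.Perm.sign σ : ℤ) : ℝ) *
      (α ![v (σ 0), v (σ 1)] * β ![v (σ 2), v (σ 3)]) := by
  have h := MultilinearMap.domCoprod_alternization_eq α β
  have h2 := congrArg (fun f => TensorProduct.lid ℝ ℝ (f (v ∘ finSumFinEquiv))) h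
  simp only [MultilinearMap.alternatization_apply, map_sum] at h2
  have h3 : 4 * wedge22 α β v =
    TensorProduct.lid ℝ ℝ (((Fintype.card (Fin 2)).factorial * (Fintype.card (Fin 2)).factorial) •
      (α.domCoprod β) (v ∘ finSumFinEquiv)) := by
    have h4 : ((Fintype.card (Fin 2)).factorial * (Fintype.card (Fin 2)).factorial) = 4 := rfl
    rw [h4, map_nsmul, nsmul_eq_mul]
    rfl
  rw [h3]
  refine Eq.trans h2.symm ?_
  refine Fintype.sum_equiv (Equiv.permCongr finSumFinEquiv) _ _ fun σ => ?_
  rw [Equiv.Perm.sign_permCongr, Units.smul_def, map_zsmul, zsmul_eq_mul]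
  congr 1
  rw [MultilinearMap.domDomCongr_apply, MultilinearMap.domCoprod_apply, TensorProduct.lid_tmul,
    smul_eq_mul]
  congr 1
  · change α _ = α _
    congr 1
    ext a b
    fin_cases a <;> rfl
  · change β _ = β _
    congr 1
    ext a b
    fin_cases a <;> rfl

theorem sum_perm_succ (n : ℕ) (f : Equiv.Perm (Fin (n + 1)) → ℝ) :
    ∑ σ, f σ = ∑ p : Fin (n + 1), ∑ e : Equiv.Perm (Fin n),
      f (Equiv.Perm.decomposeFin.symm (p, e)) := by
  rw [← Equiv.sum_comp Equiv.Perm.decomposeFin.symm, Fintype.sum_prod_type]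

theorem sum_perm4 (f : Equiv.Perm (Fin 4) → ℝ) :
    ∑ σ, f σ = ∑ p : Fin 4, ∑ q : Fin 3, ∑ r : Fin 2,
      f (Equiv.Perm.decomposeFin.symm (p, Equiv.Perm.decomposeFin.symm (q,
        Equiv.Perm.decomposeFin.symm (r, default)))) := by
  rw [sum_perm_succ 3]
  simp only [sum_perm_succ 2, sum_perm_succ 1, Fintype.sum_unique]

theorem wedge22_expand (α β : AlternatingMap ℝ (Fin 8 → ℝ) ℝ (Fin 2)) (v : Fin 4 → Fin 8 → ℝ) :
    wedge22 α β v =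
      α ![v 0, v 1] * β ![v 2, v 3] - α ![v 0, v 2] * β ![v 1, v 3]
      + α ![v 0, v 3] * β ![v 1, v 2] + α ![v 1, v 2] * β ![v 0, v 3]
      - α ![v 1, v 3] * β ![v 0, v 2] + α ![v 2, v 3] * β ![v 0, v 1] := by
  have h := four_wedge22 α β v
  have sw (γ : AlternatingMap ℝ (Fin 8 → ℝ) ℝ (Fin 2)) (x y : Fin 8 → ℝ) :
      γ ![y, x] = - γ ![x, y] := by
    have := γ.map_swap ![x, y] (i := 0) (j := 1) (by decide)
    rw [← this]
    congr 1
    ext a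
    fin_cases a <;> rfl
  rw [sum_perm4] at h
  simp only [Fin.sum_univ_four, Fin.sum_univ_three, Fin.sum_univ_two,
    Equiv.Perm.decomposeFin.symm_sign] at h
  have a2 (p : Fin 4) (e : Equiv.Perm (Fin 3)) :
      Equiv.Perm.decomposeFin.symm (p, e) 2 = Equiv.swap 0 p (e 1).succ :=
    Equiv.Perm.decomposeFin_symm_apply_succ e p 1
  have a3 (p : Fin 4) (e : Equiv.Perm (Fin 3)) :
      Equiv.Perm.decomposeFin.symm (p, e) 3 = Equiv.swap 0 p (e 2).succ :=
    Equiv.Perm.decomposeFin_symm_apply_succ e p 2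
  have b2 (p : Fin 3) (e : Equiv.Perm (Fin 2)) :
      Equiv.Perm.decomposeFin.symm (p, e) 2 = Equiv.swap 0 p (e 1).succ :=
    Equiv.Perm.decomposeFin_symm_apply_succ e p 1
  simp [a2, a3, b2, Equiv.swap_apply_def] at h
  simp only [sw _ (v 0) (v 1), sw _ (v 0) (v 2), sw _ (v 0) (v 3), sw _ (v 1) (v 2),
    sw _ (v 1) (v 3), sw _ (v 2) (v 3)] at h
  linear_combination h / 4

theorem omega_sq (v : Fin 4 → Fin 8 → ℝ) :
    wedge22 omega0 omega0 v = 2 * (dx4 0 1 2 3 v + dx4 0 1 4 5 v + dx4 0 1 6 7 v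
      + dx4 4 5 6 7 v + dx4 2 3 6 7 v + dx4 2 3 4 5 v) := by
  rw [wedge22_expand]
  simp only [omega0, AlternatingMap.add_apply, dx2_expand, dx4_expand, Matrix.cons_val_zero,
    Matrix.cons_val_one]
  ring

theorem main_pullback (φ : ℝ) :
    CayleyForm.compLinearMap (Rphi φ) =
      (1 / 2 : ℝ) • wedge22 omega0 omega0 +
        Complex.reLm.compAlternatingMap (Complex.exp (φ * Complex.I) • Theta0) := by
  ext v
  have hr : (Complex.exp (φ * Complex.I) • Theta0 v).re =
      Real.cos φ * (Theta0 v).re - Real.sin φ * (Theta0 v).im := by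
    rw [smul_eq_mul, Complex.mul_re, Complex.exp_ofReal_mul_I_re, Complex.exp_ofReal_mul_I_im]
  have hR : (((1 / 2 : ℝ) • wedge22 omega0 omega0 +
        Complex.reLm.compAlternatingMap (Complex.exp (φ * Complex.I) • Theta0)) v) =
      (1 / 2 : ℝ) * wedge22 omega0 omega0 v + (Complex.exp (φ * Complex.I) • Theta0 v).re := rfl
  have hL : (CayleyForm.compLinearMap (Rphi φ)) v = CayleyForm (fun a => Rphi φ (v a)) := rfl
  rw [hR, hr, hL, omega_sq, Theta0_re, Theta0_im]
  simp only [CayleyForm, AlternatingMap.add_apply, AlternatingMap.sub_apply]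
  rw [pull_01 φ 2 3 (by decide) (by decide), pull_01 φ 4 5 (by decide) (by decide),
    pull_01 φ 6 7 (by decide) (by decide),
    pull_0 φ 2 4 6 (by decide) (by decide) (by decide),
    pull_0 φ 2 5 7 (by decide) (by decide) (by decide),
    pull_0 φ 3 4 7 (by decide) (by decide) (by decide),
    pull_0 φ 3 5 6 (by decide) (by decide) (by decide),
    pull_1 φ 3 5 7 (by decide) (by decide) (by decide),
    pull_1 φ 3 4 6 (by decide) (by decide) (by decide),
    pull_1 φ 2 5 6 (by decide) (by decide) (by decide),
    pull_1 φ 2 4 7 (by decide) (by decide) (by decide),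
    pull_none φ 4 5 6 7 (by decide) (by decide) (by decide) (by decide),
    pull_none φ 2 3 6 7 (by decide) (by decide) (by decide) (by decide),
    pull_none φ 2 3 4 5 (by decide) (by decide) (by decide) (by decide)]
  ring

/-- `R_φ` is an orientation-preserving linear isometry of `ℝ^8`, the
pullback of the Cayley form `Ω₀` along `R_φ` is `(1/2)·ω₀∧ω₀ + Re(e^{iφ}·θ₀)`; in
particular for every `φ` this 4-form lies in the orbit of `Ω₀` under pullback by
orientation-preserving linear isometries of `ℝ^8`. -/
theorem cayley_pullback_Rphi (φ : ℝ) :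
    (∀ v w : Fin 8 → ℝ, ∑ i, Rphi φ v i * Rphi φ w i = ∑ i, v i * w i) ∧
    0 < LinearMap.det (Rphi φ) ∧
    CayleyForm.compLinearMap (Rphi φ) =
      (1 / 2 : ℝ) • wedge22 omega0 omega0 +
        Complex.reLm.compAlternatingMap (Complex.exp (φ * Complex.I) • Theta0) ∧
    ∃ R : (Fin 8 → ℝ) →ₗ[ℝ] (Fin 8 → ℝ),
      (∀ v w : Fin 8 → ℝ, ∑ i, R v i * R w i = ∑ i, v i * w i) ∧
      0 < LinearMap.det R ∧
      CayleyForm.compLinearMap R =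
        (1 / 2 : ℝ) • wedge22 omega0 omega0 +
          Complex.reLm.compAlternatingMap (Complex.exp (φ * Complex.I) • Theta0) := by
  have hd : 0 < LinearMap.det (Rphi φ) := by
    rw [Rphi_det]
    exact one_pos
  exact ⟨Rphi_isometry φ, hd, main_pullback φ,
    Rphi φ, Rphi_isometry φ, hd, main_pullback φ⟩

end
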